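/- arXiv:2605.06845 — 2 statements merged into one kernel-verified Lean document; each statement's English description precedes it below -/
import Mathlib

section
/- There exists a positive constant C' (depending only on R, λmin, λmax) such that for all Borel probability measures P, P' on ℝ supported in [−R, R] and all scales σ, σ' ∈ [λmin, λmax], one has ∫_ℝ |p_{P,σ}(x) − p_{P',σ'}(x)| dx ≥ C' · ( W₁(P,P')² + |σ − σ'| ). -/
open MeasureTheory

noncomputable section

/-- Wasserstein-1 distance on ℝ via Kantorovich–Rubinstein duality. -/
noncomputable def W1R (P P' : Measure ℝ) : ℝ :=
  sSup {r | ∃ h : ℝ → ℝ, LipschitzWith 1 h ∧ r = (∫ x, h x ∂P) - ∫ x, h x ∂P'}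

/-- The univariate Laplace kernel with location θ and scale σ. -/
noncomputable def laplaceKer (θ σ x : ℝ) : ℝ :=
  (Real.sqrt (2 * σ))⁻¹ * Real.exp (-(Real.sqrt (2 / σ) * |x - θ|))

/-- Laplace mixture density. -/
noncomputable def laplaceMix (P : Measure ℝ) (σ : ℝ) : ℝ → ℝ :=
  fun x => ∫ θ, laplaceKer θ σ x ∂P

/-- Laplace kernel, rate parametrization. -/
def lk (a u : ℝ) : ℝ := a / 2 * Real.exp (-(a * |u|))

lemma lk_cont (a : ℝ) : Continuous (lk a) := by unfold lk; fun_prop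

lemma lk_nonneg {a : ℝ} (ha : 0 < a) (u : ℝ) : 0 ≤ lk a u := by unfold lk; positivity

lemma lk_le {a : ℝ} (ha : 0 < a) (u : ℝ) : lk a u ≤ a / 2 := by
  unfold lk
  have : Real.exp (-(a * |u|)) ≤ 1 := by
    rw [Real.exp_le_one_iff]; have := abs_nonneg u; nlinarith
  nlinarith

lemma lk_neg (a u : ℝ) : lk a (-u) = lk a u := by simp [lk]

lemma lk_comm (a x y : ℝ) : lk a (x - y) = lk a (y - x) := by rw [← lk_neg]; simp

lemma expabs_integrable {a : ℝ} (ha : 0 < a) :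
    Integrable (fun u : ℝ => Real.exp (-(a * |u|))) := by
  rw [← integrableOn_univ, ← Set.Iic_union_Ioi (a := (0:ℝ))]
  refine IntegrableOn.union ?_ ?_
  · refine (integrableOn_exp_mul_Iic ha 0).congr_fun (fun x hx => ?_) measurableSet_Iic
    have : x ≤ 0 := hx
    simp only [abs_of_nonpos this]; congr 1; ring
  · refine (integrableOn_exp_mul_Ioi (neg_lt_zero.2 ha) 0).congr_fun (fun x hx => ?_)
      measurableSet_Ioi
    have : 0 < x := hx
    simp only [abs_of_pos this]; congr 1; ring

lemma expabs_integral {a : ℝ} (ha : 0 < a) :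
    ∫ u : ℝ, Real.exp (-(a * |u|)) = 2 / a := by
  rw [integral_comp_abs (f := fun u => Real.exp (-(a * u)))]
  have := integral_exp_mul_Ioi (neg_lt_zero.2 ha) 0
  simp only [neg_mul] at this
  rw [this]; simp; field_simp

lemma lk_integrable {a : ℝ} (ha : 0 < a) : Integrable (lk a) :=
  (expabs_integrable ha).const_mul _

lemma lk_integral {a : ℝ} (ha : 0 < a) : ∫ u, lk a u = 1 := by
  unfold lk
  rw [integral_const_mul, expabs_integral ha]; field_simp

lemma conv_nonneg {a b d : ℝ} (ha : 0 < a) (hb : 0 < b) (hab : a ≠ b) (hd : 0 ≤ d) :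
    ∫ x : ℝ, Real.exp (-(a * |x|)) * Real.exp (-(b * |x - d|)) =
      (2 * a * Real.exp (-(b * d)) - 2 * b * Real.exp (-(a * d))) / (a ^ 2 - b ^ 2) := by
  have hint : Integrable (fun x : ℝ => Real.exp (-(a * |x|)) * Real.exp (-(b * |x - d|))) := by
    refine (expabs_integrable ha).mul_bdd (c := 1) ?_ ?_
    · exact (by fun_prop : Continuous fun x : ℝ => Real.exp (-(b * |x - d|))).aestronglyMeasurable
    · filter_upwards with x
      rw [Real.norm_eq_abs, Real.abs_exp, Real.exp_le_one_iff]
      have := abs_nonneg (x - d); nlinarith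
  have hab2 : a - b ≠ 0 := sub_ne_zero.2 hab
  have hs : a ^ 2 - b ^ 2 ≠ 0 := by
    have : a ^ 2 - b ^ 2 = (a - b) * (a + b) := by ring
    rw [this]; exact mul_ne_zero hab2 (by positivity)
  have e1 : ∫ x in Set.Iic (0:ℝ), Real.exp (-(a * |x|)) * Real.exp (-(b * |x - d|)) =
      Real.exp (-(b * d)) / (a + b) := by
    have : ∫ x in Set.Iic (0:ℝ), Real.exp (-(a * |x|)) * Real.exp (-(b * |x - d|)) =
        ∫ x in Set.Iic (0:ℝ), Real.exp (-(b * d)) * Real.exp ((a + b) * x) := by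
      refine setIntegral_congr_fun measurableSet_Iic (fun x hx => ?_)
      have hx' : x ≤ 0 := hx
      simp only [← Real.exp_add]
      rw [abs_of_nonpos hx', abs_of_nonpos (by linarith : x - d ≤ 0)]; congr 1; ring
    rw [this, integral_const_mul, integral_exp_mul_Iic (by positivity)]; simp; ring
  have e3 : ∫ x in Set.Ioi d, Real.exp (-(a * |x|)) * Real.exp (-(b * |x - d|)) =
      Real.exp (-(a * d)) / (a + b) := by
    have : ∫ x in Set.Ioi d, Real.exp (-(a * |x|)) * Real.exp (-(b * |x - d|)) =
        ∫ x in Set.Ioi d, Real.exp (b * d) * Real.exp ((-(a + b)) * x) := by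
      refine setIntegral_congr_fun measurableSet_Ioi (fun x hx => ?_)
      have hx' : d < x := hx
      simp only [← Real.exp_add]
      rw [abs_of_nonneg (by linarith : 0 ≤ x), abs_of_nonneg (by linarith : 0 ≤ x - d)]
      congr 1; ring
    rw [this, integral_const_mul, integral_exp_mul_Ioi (by linarith)]
    rw [neg_div_neg_eq, mul_div_assoc', ← Real.exp_add]; congr 2; ring
  have e2 : ∫ x in Set.Ioc 0 d, Real.exp (-(a * |x|)) * Real.exp (-(b * |x - d|)) =
      (Real.exp (-(b * d)) - Real.exp (-(a * d))) / (a - b) := by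
    have : ∫ x in Set.Ioc 0 d, Real.exp (-(a * |x|)) * Real.exp (-(b * |x - d|)) =
        ∫ x in Set.Ioc 0 d, Real.exp (-(b * d) - (a - b) * x) := by
      refine setIntegral_congr_fun measurableSet_Ioc (fun x hx => ?_)
      simp only [← Real.exp_add]
      rw [abs_of_pos hx.1, abs_of_nonpos (by linarith [hx.2] : x - d ≤ 0)]
      congr 1; ring
    rw [this, ← intervalIntegral.integral_of_le hd]
    rw [intervalIntegral.integral_eq_sub_of_hasDerivAt
      (f := fun x => -(Real.exp (-(b * d) - (a - b) * x) / (a - b)))]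
    · have : -(b * d) - (a - b) * d = -(a * d) := by ring
      simp only [this]; simp; ring
    · intro x _
      have h1 : HasDerivAt (fun x : ℝ => -(b * d) - (a - b) * x) (-(a - b)) x := by
        simpa using ((hasDerivAt_id x).const_mul (a - b)).const_sub (-(b * d))
      have := (h1.exp.div_const (a - b)).neg
      refine (this.congr_deriv ?_)
      field_simp
    · exact (by fun_prop : Continuous _).intervalIntegrable _ _
  rw [← integral_add_compl (measurableSet_Iic (a := (0:ℝ))) hint, Set.compl_Iic,
    ← Set.Ioc_union_Ioi_eq_Ioi hd,
    setIntegral_union (Set.Ioc_disjoint_Ioi le_rfl) measurableSet_Ioi hint.integrableOn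
      hint.integrableOn, e1, e2, e3]
  have : a + b ≠ 0 := by positivity
  field_simp
  ring

lemma conv_all {a b : ℝ} (d : ℝ) (ha : 0 < a) (hb : 0 < b) (hab : a ≠ b) :
    ∫ x : ℝ, Real.exp (-(a * |x|)) * Real.exp (-(b * |x - d|)) =
      (2 * a * Real.exp (-(b * |d|)) - 2 * b * Real.exp (-(a * |d|))) / (a ^ 2 - b ^ 2) := by
  rcases le_total 0 d with hd | hd
  · rw [conv_nonneg ha hb hab hd, abs_of_nonneg hd]
  · rw [← integral_neg_eq_self, abs_of_nonpos hd, ← conv_nonneg ha hb hab (neg_nonneg.2 hd)]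
    congr 1; ext x
    rw [abs_neg, ← abs_neg (-x - d)]; congr 5; ring

lemma lk_conv {a b : ℝ} (θ y : ℝ) (ha : 0 < a) (hb : 0 < b) :
    (1 - b ^ 2 / a ^ 2) * ∫ x, lk a (x - θ) * lk b (x - y) =
      lk b (θ - y) - b ^ 2 / a ^ 2 * lk a (θ - y) := by
  by_cases hab : a = b
  · subst hab
    have : a ^ 2 / a ^ 2 = 1 := div_self (by positivity)
    rw [this]; ring
  have h1 : ∫ x, lk a (x - θ) * lk b (x - y) = ∫ x, lk a x * lk b (x - (y - θ)) := by
    rw [← integral_add_right_eq_self _ θ]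
    congr 1; ext x; congr 2 <;> ring
  have h2 : ∀ x, lk a x * lk b (x - (y - θ)) = a * b / 4 *
     (Real.exp (-(a * |x|)) * Real.exp (-(b * |x - (y - θ)|))) := by
    intro x; unfold lk; ring
  have hs : a ^ 2 - b ^ 2 ≠ 0 := by
    have : a ^ 2 - b ^ 2 = (a - b) * (a + b) := by ring
    rw [this]; exact mul_ne_zero (sub_ne_zero.2 hab) (by positivity)
  rw [h1]
  simp_rw [h2]
  rw [integral_const_mul, conv_all _ ha hb hab]
  unfold lk
  rw [abs_sub_comm θ y]
  field_simp
  ring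

/-- Laplace smoothing of `h`. -/
def sm (b : ℝ) (h : ℝ → ℝ) (x : ℝ) : ℝ := ∫ y, lk b (x - y) * h y

lemma lk_shift_integrable {a : ℝ} (ha : 0 < a) (x : ℝ) : Integrable fun y => lk a (x - y) :=
  (lk_integrable ha).comp_sub_left x

lemma lk_shift_integral {a : ℝ} (ha : 0 < a) (x : ℝ) : ∫ y, lk a (x - y) = 1 := by
  rw [integral_sub_left_eq_self (fun u => lk a u), lk_integral ha]

lemma lk_mul_integrable {a R : ℝ} (ha : 0 < a) (x : ℝ) {h : ℝ → ℝ} (hh : Measurable h)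
    (hb : ∀ x, |h x| ≤ R) : Integrable fun y => lk a (x - y) * h y :=
  (lk_shift_integrable ha x).mul_bdd (c := R) hh.aestronglyMeasurable
    (Filter.Eventually.of_forall hb)

lemma sm_meas {b : ℝ} {h : ℝ → ℝ} (hh : Measurable h) : Measurable (sm b h) := by
  have : StronglyMeasurable (fun p : ℝ × ℝ => lk b (p.1 - p.2) * h p.2) := by
    have := (lk_cont b).measurable
    apply Measurable.stronglyMeasurable
    fun_prop
  exact this.integral_prod_right'.measurable

lemma sm_bound {b R : ℝ} (hb : 0 < b) {h : ℝ → ℝ} (hB : ∀ x, |h x| ≤ R) (x : ℝ) :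
    |sm b h x| ≤ R := by
  have := norm_integral_le_of_norm_le (f := fun y => lk b (x - y) * h y)
    (g := fun y => lk b (x - y) * R)
    ((lk_shift_integrable hb x).mul_const R) (Filter.Eventually.of_forall fun y => by
      rw [norm_mul, Real.norm_eq_abs, Real.norm_eq_abs, abs_of_nonneg (lk_nonneg hb _)]
      exact mul_le_mul_of_nonneg_left (hB y) (lk_nonneg hb _))
  rw [integral_mul_const, lk_shift_integral hb, one_mul] at this
  exact this

lemma sm_dev {b R : ℝ} (hb : 0 < b) {h : ℝ → ℝ} (hL : LipschitzWith 1 h) (hB : ∀ x, |h x| ≤ R)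
    (x : ℝ) : |sm b h x - h x| ≤ 4 / b := by
  have hm : Measurable h := hL.continuous.measurable
  have e : sm b h x - h x = ∫ y, lk b (x - y) * (h y - h x) := by
    simp_rw [mul_sub]
    rw [integral_sub (lk_mul_integrable hb x hm hB) ((lk_shift_integrable hb x).mul_const _),
      integral_mul_const, lk_shift_integral hb, one_mul]
    rfl
  have hi : Integrable fun y => Real.exp (-(b / 2 * |x - y|)) :=
    (expabs_integrable (half_pos hb)).comp_sub_left x
  have := norm_integral_le_of_norm_le (f := fun y => lk b (x - y) * (h y - h x)) hi
    (Filter.Eventually.of_forall fun y => by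
      have h1 : |h y - h x| ≤ |x - y| := by
        have := hL.dist_le_mul y x
        rw [Real.dist_eq, Real.dist_eq] at this
        rw [abs_sub_comm x y]; simpa using this
      have h2 : b / 2 * |x - y| ≤ Real.exp (b / 2 * |x - y|) := by
        linarith [Real.add_one_le_exp (b / 2 * |x - y|)]
      rw [norm_mul, Real.norm_eq_abs, Real.norm_eq_abs, abs_of_nonneg (lk_nonneg hb _)]
      calc lk b (x - y) * |h y - h x| ≤ lk b (x - y) * |x - y| :=
            mul_le_mul_of_nonneg_left h1 (lk_nonneg hb _)
        _ = Real.exp (-(b * |x - y|)) * (b / 2 * |x - y|) := by unfold lk; ring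
        _ ≤ Real.exp (-(b * |x - y|)) * Real.exp (b / 2 * |x - y|) :=
            mul_le_mul_of_nonneg_left h2 (Real.exp_pos _).le
        _ = Real.exp (-(b / 2 * |x - y|)) := by rw [← Real.exp_add]; congr 1; ring)
  rw [integral_sub_left_eq_self (fun u => Real.exp (-(b / 2 * |u|))),
    expabs_integral (half_pos hb)] at this
  rw [e]
  refine this.trans (le_of_eq ?_)
  field_simp; norm_num

/-- The resolvent identity: the test function `(1 - b²/a²) sm b h + b²/a² h` is mapped to
`sm b h`. -/
lemma lk_resolvent {a b R : ℝ} (θ : ℝ) (ha : 0 < a) (hb : 0 < b) {h : ℝ → ℝ} (hh : Measurable h)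
    (hB : ∀ x, |h x| ≤ R) :
    ∫ x, lk a (x - θ) * ((1 - b ^ 2 / a ^ 2) * sm b h x + b ^ 2 / a ^ 2 * h x) = sm b h θ := by
  have hp : Integrable (fun p : ℝ × ℝ => lk a (p.2 - θ) * lk b (p.1 - p.2))
      (volume.prod volume) :=
    ((lk_integrable ha).comp_sub_right θ).convolution_integrand (ContinuousLinearMap.mul ℝ ℝ)
      (lk_integrable hb)
  have hp2 : Integrable (fun p : ℝ × ℝ => lk a (p.2 - θ) * lk b (p.1 - p.2) * h p.1)
      (volume.prod volume) :=
    hp.mul_bdd (c := R) (hh.comp measurable_fst).aestronglyMeasurable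
      (Filter.Eventually.of_forall fun p => hB p.1)
  have i1 : Integrable (fun x => lk a (x - θ) * sm b h x) := by
    simp_rw [lk_comm a _ θ]
    exact lk_mul_integrable ha θ (sm_meas hh) (sm_bound hb hB)
  have i2 : Integrable (fun x => lk a (x - θ) * h x) := by
    simp_rw [lk_comm a _ θ]
    exact lk_mul_integrable ha θ hh hB
  have sw : ∫ x, lk a (x - θ) * sm b h x = ∫ y, (∫ x, lk a (x - θ) * lk b (x - y)) * h y := by
    have := integral_integral_swap (f := fun y x => lk a (x - θ) * lk b (y - x) * h y) hp2
    calc ∫ x, lk a (x - θ) * sm b h x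
        = ∫ x, ∫ y, lk a (x - θ) * lk b (y - x) * h y := by
          congr 1; ext x
          unfold sm
          rw [← integral_const_mul]
          congr 1; ext y; rw [lk_comm b x y]; ring
      _ = _ := this.symm
      _ = _ := by
          congr 1; ext y
          rw [← integral_mul_const]
          congr 1; ext x; rw [lk_comm b x y]
  calc _ = (1 - b ^ 2 / a ^ 2) * (∫ x, lk a (x - θ) * sm b h x)
        + b ^ 2 / a ^ 2 * ∫ x, lk a (x - θ) * h x := by
        rw [← integral_const_mul, ← integral_const_mul, ← integral_add (i1.const_mul _)
          (i2.const_mul _)]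
        congr 1; ext x; ring
    _ = (∫ y, ((1 - b ^ 2 / a ^ 2) * ∫ x, lk a (x - θ) * lk b (x - y)) * h y)
        + b ^ 2 / a ^ 2 * ∫ x, lk a (x - θ) * h x := by
        rw [sw, ← integral_const_mul]; congr 2; ext y; ring
    _ = _ := by
        simp_rw [lk_conv _ _ ha hb, sub_mul, mul_assoc]
        rw [integral_sub (lk_mul_integrable hb θ hh hB)
          ((lk_mul_integrable ha θ hh hB).const_mul _), integral_const_mul]
        simp_rw [lk_comm a _ θ]
        unfold sm; ring

/-- Mixture in the rate parametrization. -/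
def mixr (P : Measure ℝ) (a x : ℝ) : ℝ := ∫ θ, lk a (x - θ) ∂P

lemma laplaceMix_eq (P : Measure ℝ) {σ : ℝ} (hσ : 0 < σ) :
    laplaceMix P σ = mixr P (Real.sqrt (2 / σ)) := by
  ext x
  unfold laplaceMix mixr laplaceKer lk
  have : (Real.sqrt (2 * σ))⁻¹ = Real.sqrt (2 / σ) / 2 := by
    rw [Real.sqrt_mul (by norm_num), Real.sqrt_div (by norm_num)]
    have h2 : Real.sqrt 2 * Real.sqrt 2 = 2 := Real.mul_self_sqrt (by norm_num)
    have : 0 < Real.sqrt 2 := by positivity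
    have : 0 < Real.sqrt σ := by positivity
    field_simp
    nlinarith
  rw [this]

lemma mix_prod {P : Measure ℝ} [IsProbabilityMeasure P] {a : ℝ} (ha : 0 < a) :
    Integrable (fun p : ℝ × ℝ => lk a (p.1 - p.2)) ((volume : Measure ℝ).prod P) := by
  have := (integrable_const (1:ℝ) (μ := P)).convolution_integrand (ContinuousLinearMap.mul ℝ ℝ)
      (lk_integrable ha)
  simpa using this

lemma mix_integrable {P : Measure ℝ} [IsProbabilityMeasure P] {a : ℝ} (ha : 0 < a) :
    Integrable (mixr P a) := (mix_prod ha).integral_prod_left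

lemma mix_nonneg {P : Measure ℝ} {a : ℝ} (ha : 0 < a) (x : ℝ) :
    0 ≤ mixr P a x := integral_nonneg fun _ => lk_nonneg ha _

lemma mix_pair {P : Measure ℝ} [IsProbabilityMeasure P] {a M : ℝ} (ha : 0 < a) {φ : ℝ → ℝ}
    (hφ : Measurable φ) (hB : ∀ x, |φ x| ≤ M) :
    ∫ x, mixr P a x * φ x = ∫ θ, (∫ x, lk a (x - θ) * φ x) ∂P := by
  have hp2 : Integrable (fun p : ℝ × ℝ => lk a (p.1 - p.2) * φ p.1)
      ((volume : Measure ℝ).prod P) :=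
    (mix_prod ha).mul_bdd (c := M) (hφ.comp measurable_fst).aestronglyMeasurable
      (Filter.Eventually.of_forall fun p => hB p.1)
  have := integral_integral_swap (f := fun x θ => lk a (x - θ) * φ x) hp2
  rw [← this]
  congr 1; ext x
  rw [integral_mul_const]; rfl

lemma mix_integral {P : Measure ℝ} [IsProbabilityMeasure P] {a : ℝ} (ha : 0 < a) :
    ∫ x, mixr P a x = 1 := by
  have := mix_pair (P := P) (M := 1) ha (φ := fun _ => 1) measurable_const (by simp)
  simp only [mul_one] at this
  rw [this]
  simp_rw [integral_sub_right_eq_self (fun u => lk a u), lk_integral ha]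
  simp

lemma bdd_integrable {P : Measure ℝ} [IsProbabilityMeasure P] {h : ℝ → ℝ} {R : ℝ}
    (hh : Measurable h) (hB : ∀ x, |h x| ≤ R) : Integrable h P :=
  Integrable.of_bound hh.aestronglyMeasurable R (Filter.Eventually.of_forall hB)

lemma key_bound {P P' : Measure ℝ} [IsProbabilityMeasure P] [IsProbabilityMeasure P']
    {a a' b R : ℝ} (ha : 0 < a) (ha' : 0 < a') (hb : 0 < b) {h : ℝ → ℝ}
    (hL : LipschitzWith 1 h) (hB : ∀ x, |h x| ≤ R) :
    (∫ x, h x ∂P) - ∫ x, h x ∂P' ≤ 8 / b +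
      (R + b ^ 2 / a ^ 2 * (4 / b)) * (∫ x, |mixr P a x - mixr P' a' x|)
      + |b ^ 2 / a ^ 2 - b ^ 2 / a' ^ 2| * (4 / b) := by
  have hm : Measurable h := hL.continuous.measurable
  set g := sm b h with hg
  have gm : Measurable g := sm_meas hm
  have gB : ∀ x, |g x| ≤ R := sm_bound hb hB
  have dev : ∀ x, |g x - h x| ≤ 4 / b := sm_dev hb hL hB
  have hφm : ∀ c : ℝ, Measurable fun x => (1 - c) * g x + c * h x := fun c => by fun_prop
  have hφB : ∀ c : ℝ, 0 ≤ c → ∀ x, |(1 - c) * g x + c * h x| ≤ R + c * (4 / b) := by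
    intro c hc x
    have : (1 - c) * g x + c * h x = g x - c * (g x - h x) := by ring
    rw [this]
    calc _ ≤ |g x| + |c * (g x - h x)| := abs_sub _ _
      _ ≤ _ := by
        rw [abs_mul, abs_of_nonneg hc]
        exact add_le_add (gB x) (mul_le_mul_of_nonneg_left (dev x) hc)
  set c := b ^ 2 / a ^ 2 with hcdef
  set c' := b ^ 2 / a' ^ 2 with hcdef'
  have hc : 0 ≤ c := by positivity
  have hc' : 0 ≤ c' := by positivity
  have e1 : ∫ x, mixr P a x * ((1 - c) * g x + c * h x) = ∫ x, g x ∂P := by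
    rw [mix_pair ha (hφm c) (hφB c hc)]
    congr 1; ext θ; exact lk_resolvent θ ha hb hm hB
  have e2 : ∫ x, mixr P' a' x * ((1 - c') * g x + c' * h x) = ∫ x, g x ∂P' := by
    rw [mix_pair ha' (hφm c') (hφB c' hc')]
    congr 1; ext θ; exact lk_resolvent θ ha' hb hm hB
  have i1 : Integrable fun x => mixr P a x * ((1 - c) * g x + c * h x) :=
    (mix_integrable ha).mul_bdd (hφm c).aestronglyMeasurable
      (Filter.Eventually.of_forall (hφB c hc))
  have i2 : Integrable fun x => mixr P' a' x * ((1 - c') * g x + c' * h x) :=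
    (mix_integrable ha').mul_bdd (hφm c').aestronglyMeasurable
      (Filter.Eventually.of_forall (hφB c' hc'))
  have i3 : Integrable fun x => |mixr P a x - mixr P' a' x| :=
    ((mix_integrable ha).sub (mix_integrable ha')).abs
  have m : (∫ x, g x ∂P) - ∫ x, g x ∂P' ≤
      (R + c * (4 / b)) * (∫ x, |mixr P a x - mixr P' a' x|) + |c - c'| * (4 / b) := by
    rw [← e1, ← e2, ← integral_sub i1 i2]
    have : (R + c * (4 / b)) * (∫ x, |mixr P a x - mixr P' a' x|) + |c - c'| * (4 / b) =
        ∫ x, ((R + c * (4 / b)) * |mixr P a x - mixr P' a' x|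
          + |c - c'| * (4 / b) * mixr P' a' x) := by
      rw [integral_add (i3.const_mul _) ((mix_integrable ha').const_mul _), integral_const_mul,
        integral_const_mul, mix_integral ha', mul_one]
    rw [this]
    refine integral_mono (i1.sub i2)
      ((i3.const_mul _).add ((mix_integrable ha').const_mul _)) fun x => ?_
    have e : mixr P a x * ((1 - c) * g x + c * h x) - mixr P' a' x * ((1 - c') * g x + c' * h x)
      = ((1 - c) * g x + c * h x) * (mixr P a x - mixr P' a' x)
        - ((c - c') * (g x - h x)) * mixr P' a' x := by ring
    simp only [e]
    have t1 : ((1 - c) * g x + c * h x) * (mixr P a x - mixr P' a' x) ≤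
        (R + c * (4 / b)) * |mixr P a x - mixr P' a' x| := by
      refine (le_abs_self _).trans ?_
      rw [abs_mul]
      exact mul_le_mul_of_nonneg_right (hφB c hc x) (abs_nonneg _)
    have t2 : -((c - c') * (g x - h x)) ≤ |c - c'| * (4 / b) := by
      refine (neg_le_abs _).trans ?_
      rw [abs_mul]
      exact mul_le_mul_of_nonneg_left (dev x) (abs_nonneg _)
    have t3 := mul_le_mul_of_nonneg_right t2 (mix_nonneg (P := P') ha' x)
    linarith
  have d1 : (∫ x, h x ∂P) - ∫ x, g x ∂P ≤ 4 / b := by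
    rw [← integral_sub (bdd_integrable hm hB) (bdd_integrable gm gB)]
    have : 4 / b = ∫ x, 4 / b ∂P := by simp
    rw [this]
    refine integral_mono ((bdd_integrable hm hB).sub (bdd_integrable gm gB))
      (integrable_const _) fun x => ?_
    have := (abs_le.1 (dev x)).1
    simp only; linarith
  have d2 : (∫ x, g x ∂P') - ∫ x, h x ∂P' ≤ 4 / b := by
    rw [← integral_sub (bdd_integrable gm gB) (bdd_integrable hm hB)]
    have : 4 / b = ∫ x, 4 / b ∂P' := by simp
    rw [this]
    refine integral_mono ((bdd_integrable gm gB).sub (bdd_integrable hm hB))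
      (integrable_const _) fun x => ?_
    have := (abs_le.1 (dev x)).2
    simp only; linarith
  have : 8 / b = 4 / b + 4 / b := by ring
  linarith

lemma clip_lemma {R : ℝ} (hR : 0 < R) {h : ℝ → ℝ} (hL : LipschitzWith 1 h) :
    ∃ k : ℝ → ℝ, LipschitzWith 1 k ∧ (∀ x, |k x| ≤ R) ∧ ∀ P P' : Measure ℝ,
      IsProbabilityMeasure P → IsProbabilityMeasure P' →
      P (Set.Icc (-R) R)ᶜ = 0 → P' (Set.Icc (-R) R)ᶜ = 0 →
      (∫ x, h x ∂P) - (∫ x, h x ∂P') = (∫ x, k x ∂P) - ∫ x, k x ∂P' := by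
  set k : ℝ → ℝ := fun x => h (max (-R) (min R x)) - h 0 with hk
  have hd : ∀ x y, |h x - h y| ≤ |x - y| := fun x y => by
    have := hL.dist_le_mul x y
    simpa [Real.dist_eq] using this
  have kL : LipschitzWith 1 k := by
    apply LipschitzWith.of_dist_le_mul
    intro x y
    simp only [Real.dist_eq, hk, NNReal.coe_one, one_mul]
    have h1 := hd (max (-R) (min R x)) (max (-R) (min R y))
    have h2 : |max (-R) (min R x) - max (-R) (min R y)| ≤ |x - y| := by
      refine (abs_max_sub_max_le_max _ _ _ _).trans ?_
      simp only [sub_self, abs_zero]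
      refine max_le (abs_nonneg _) ((abs_min_sub_min_le_max _ _ _ _).trans ?_)
      simp
    have : h (max (-R) (min R x)) - h 0 - (h (max (-R) (min R y)) - h 0) =
      h (max (-R) (min R x)) - h (max (-R) (min R y)) := by ring
    rw [this]; linarith
  have kB : ∀ x, |k x| ≤ R := by
    intro x
    refine (hd _ _).trans ?_
    rw [sub_zero, abs_le]
    exact ⟨le_max_left _ _, max_le (by linarith) (min_le_left _ _)⟩
  refine ⟨k, kL, kB, ?_⟩
  have main : ∀ P : Measure ℝ, IsProbabilityMeasure P → P (Set.Icc (-R) R)ᶜ = 0 →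
      ∫ x, h x ∂P = (∫ x, k x ∂P) + h 0 := by
    intro P _ hP
    have ae : ∀ᵐ x ∂P, x ∈ Set.Icc (-R) R := hP
    have : ∫ x, h x ∂P = ∫ x, (k x + h 0) ∂P := by
      refine integral_congr_ae ?_
      filter_upwards [ae] with x hx
      simp only [hk]
      rw [min_eq_right hx.2, max_eq_right hx.1]; ring
    rw [this, integral_add (bdd_integrable kL.continuous.measurable kB) (integrable_const _)]
    simp
  intro P P' h1 h2 h3 h4
  rw [main P h1 h3, main P' h2 h4]; ring

lemma mix_tail {P : Measure ℝ} [IsProbabilityMeasure P] {a R x : ℝ}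
    (hP : P (Set.Icc (-R) R)ᶜ = 0) (hx : R ≤ x) :
    mixr P a (x + 1) = Real.exp (-a) * mixr P a x := by
  have ae : ∀ᵐ x ∂P, x ∈ Set.Icc (-R) R := hP
  unfold mixr
  rw [← integral_const_mul]
  refine integral_congr_ae ?_
  filter_upwards [ae] with θ hθ
  have := hθ.2
  unfold lk
  rw [abs_of_nonneg (by linarith), abs_of_nonneg (by linarith), mul_left_comm, ← Real.exp_add]
  congr 2; ring

lemma mix_lower {P : Measure ℝ} [IsProbabilityMeasure P] {a m M R x : ℝ} (hm : 0 < m)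
    (hma : m ≤ a) (haM : a ≤ M) (hR : 0 < R)
    (hP : P (Set.Icc (-R) R)ᶜ = 0) (hx : R ≤ x) (hx' : x ≤ R + 1) :
    m / 2 * Real.exp (-(M * (2 * R + 1))) ≤ mixr P a x := by
  have ae : ∀ᵐ x ∂P, x ∈ Set.Icc (-R) R := hP
  have ha : 0 < a := by linarith
  have : m / 2 * Real.exp (-(M * (2 * R + 1))) =
    ∫ θ, m / 2 * Real.exp (-(M * (2 * R + 1))) ∂P := by simp
  rw [this]
  refine integral_mono_ae (integrable_const _) ?_ ?_
  · have := lk_cont a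
    refine bdd_integrable (R := a / 2) (by fun_prop) fun θ => ?_
    rw [abs_of_nonneg (lk_nonneg ha _)]; exact lk_le ha _
  · filter_upwards [ae] with θ hθ
    unfold lk
    have h1 := hθ.1
    have h2 := hθ.2
    rw [abs_of_nonneg (by linarith)]
    have : a * (x - θ) ≤ M * (2 * R + 1) := by
      apply mul_le_mul haM <;> linarith
    gcongr

lemma exp_diff {a a' M : ℝ} (ha : a ≤ M) (ha' : a' ≤ M) :
    Real.exp (-M) * |a - a'| ≤ |Real.exp (-a) - Real.exp (-a')| := by
  wlog h : a ≤ a' generalizing a a'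
  · rw [abs_sub_comm, abs_sub_comm (Real.exp _)]
    exact this ha' ha (le_of_not_ge h)
  rw [abs_of_nonpos (by linarith : a - a' ≤ 0)]
  refine le_trans ?_ (le_abs_self _)
  have e : Real.exp (-a) = Real.exp (-a') * Real.exp (a' - a) := by
    rw [← Real.exp_add]; congr 1; ring
  have h1 := Real.add_one_le_exp (a' - a)
  have h2 : Real.exp (-M) ≤ Real.exp (-a') := Real.exp_le_exp.2 (by linarith)
  have h3 := mul_le_mul_of_nonneg_left h1 (Real.exp_pos (-a')).le
  have h4 := mul_le_mul_of_nonneg_right h2 (by linarith : 0 ≤ a' - a)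
  nlinarith

lemma sigma_step {P P' : Measure ℝ} [IsProbabilityMeasure P] [IsProbabilityMeasure P']
    {a a' m M R : ℝ} (hm : 0 < m) (hma : m ≤ a) (haM : a ≤ M) (hma' : m ≤ a') (haM' : a' ≤ M)
    (hR : 0 < R) (hP : P (Set.Icc (-R) R)ᶜ = 0) (hP' : P' (Set.Icc (-R) R)ᶜ = 0) :
    Real.exp (-M) * |a - a'| * (m / 2 * Real.exp (-(M * (2 * R + 1)))) ≤
      2 * ∫ x, |mixr P a x - mixr P' a' x| := by
  have ha : 0 < a := by linarith
  have ha' : 0 < a' := by linarith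
  set K := Real.exp (-M) * |a - a'| * (m / 2 * Real.exp (-(M * (2 * R + 1)))) with hK
  set Δ : ℝ → ℝ := fun x => |mixr P a x - mixr P' a' x| with hΔ
  have i3 : Integrable Δ := ((mix_integrable ha).sub (mix_integrable ha')).abs
  have i4 : Integrable fun x => Δ (x + 1) + Δ x := (i3.comp_add_right 1).add i3
  have e : 2 * ∫ x, Δ x = ∫ x, (Δ (x + 1) + Δ x) := by
    rw [integral_add (i3.comp_add_right 1) i3, integral_add_right_eq_self Δ]; ring
  rw [e]
  have hpt : ∀ x ∈ Set.Icc R (R + 1), K ≤ Δ (x + 1) + Δ x := by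
    intro x hx
    simp only [hΔ]
    rw [mix_tail hP hx.1, mix_tail hP' hx.1]
    have l := mix_lower hm hma' haM' hR hP' hx.1 hx.2
    have q := mul_le_mul (exp_diff haM haM') l (by positivity) (abs_nonneg _)
    rw [← hK] at q
    refine q.trans ?_
    rw [← abs_of_nonneg (mix_nonneg (P := P') ha' x), ← abs_mul,
      abs_of_nonneg (mix_nonneg (P := P') ha' x)]
    have : (Real.exp (-a) - Real.exp (-a')) * mixr P' a' x =
      (Real.exp (-a) * mixr P a x - Real.exp (-a') * mixr P' a' x)
        - Real.exp (-a) * (mixr P a x - mixr P' a' x) := by ring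
    rw [this]
    refine (abs_sub _ _).trans ?_
    rw [abs_mul, Real.abs_exp]
    have : Real.exp (-a) ≤ 1 := by rw [Real.exp_le_one_iff]; linarith
    have := mul_le_mul_of_nonneg_right this (abs_nonneg (mixr P a x - mixr P' a' x))
    linarith
  calc K = ∫ x in Set.Icc R (R + 1), K := by simp
    _ ≤ ∫ x in Set.Icc R (R + 1), (Δ (x + 1) + Δ x) :=
      setIntegral_mono_on (by simp) i4.integrableOn measurableSet_Icc hpt
    _ ≤ _ := setIntegral_le_integral i4 (Filter.Eventually.of_forall fun x =>
        add_nonneg (abs_nonneg _) (abs_nonneg _))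

theorem laplace_inverse_bound
    (R lmin lmax : ℝ) (hR : 0 < R) (hlmin : 0 < lmin) (hl : lmin < lmax) :
    ∃ C' : ℝ, 0 < C' ∧
      ∀ (P P' : Measure ℝ), IsProbabilityMeasure P → IsProbabilityMeasure P' →
        P (Set.Icc (-R) R)ᶜ = 0 → P' (Set.Icc (-R) R)ᶜ = 0 →
        ∀ σ ∈ Set.Icc lmin lmax, ∀ σ' ∈ Set.Icc lmin lmax,
          C' * (W1R P P' ^ 2 + |σ - σ'|) ≤
          ∫ x, |laplaceMix P σ x - laplaceMix P' σ' x| := by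
  have hlmax : 0 < lmax := hlmin.trans hl
  set m := Real.sqrt (2 / lmax) with hm
  set M := Real.sqrt (2 / lmin) with hM
  have mpos : 0 < m := by positivity
  have Mpos : 0 < M := by positivity
  set c1 := Real.exp (-M) * (1 / (lmax ^ 2 * M)) *
    (m / 2 * Real.exp (-(M * (2 * R + 1)))) / 2 with hc1
  have c1pos : 0 < c1 := by positivity
  set K := 8 + 2 * R + 2 * lmax + 2 / c1 with hK
  have Kpos : 0 < K := by positivity
  refine ⟨1 / (K ^ 2 + 1 / c1), by positivity, ?_⟩
  intro P P' _ _ hP hP' σ hσ σ' hσ'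
  have σpos : 0 < σ := hlmin.trans_le hσ.1
  have σpos' : 0 < σ' := hlmin.trans_le hσ'.1
  rw [laplaceMix_eq P σpos, laplaceMix_eq P' σpos']
  set a := Real.sqrt (2 / σ) with hadef
  set a' := Real.sqrt (2 / σ') with hadef'
  have ha2 : a ^ 2 = 2 / σ := Real.sq_sqrt (by positivity)
  have ha2' : a' ^ 2 = 2 / σ' := Real.sq_sqrt (by positivity)
  have ha : 0 < a := by positivity
  have ha' : 0 < a' := by positivity
  have h1 : m ≤ a := Real.sqrt_le_sqrt (by gcongr; exact hσ.2)
  have h2 : m ≤ a' := Real.sqrt_le_sqrt (by gcongr; exact hσ'.2)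
  have h3 : a ≤ M := Real.sqrt_le_sqrt (by gcongr; exact hσ.1)
  have h4 : a' ≤ M := Real.sqrt_le_sqrt (by gcongr; exact hσ'.1)
  set D := ∫ x, |mixr P a x - mixr P' a' x| with hD
  have D0 : 0 ≤ D := integral_nonneg fun _ => abs_nonneg _
  have D2 : D ≤ 2 := by
    have : (2:ℝ) = ∫ x, (mixr P a x + mixr P' a' x) := by
      rw [integral_add (mix_integrable ha) (mix_integrable ha'), mix_integral ha,
        mix_integral ha']; norm_num
    rw [this]
    refine integral_mono ((mix_integrable ha).sub (mix_integrable ha')).abs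
      ((mix_integrable ha).add (mix_integrable ha')) fun x => ?_
    refine (abs_sub _ _).trans ?_
    rw [abs_of_nonneg (mix_nonneg ha x), abs_of_nonneg (mix_nonneg ha' x)]
  have s1 : c1 * |σ - σ'| ≤ D := by
    have s := sigma_step mpos h1 h3 h2 h4 hR hP hP'
    rw [← hD] at s
    have t : 1 / (lmax ^ 2 * M) * |σ - σ'| ≤ |a - a'| := by
      have e : |a - a'| * (a + a') * (σ * σ') = 2 * |σ - σ'| := by
        have : (a - a') * (a + a') * (σ * σ') = 2 * (σ' - σ) := by
          have : (a - a') * (a + a') = a ^ 2 - a' ^ 2 := by ring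
          rw [this, ha2, ha2']; field_simp
        have := congrArg abs this
        rwa [abs_mul, abs_mul, abs_of_pos (by positivity : 0 < a + a'),
          abs_of_pos (by positivity : 0 < σ * σ'), abs_mul, abs_two, abs_sub_comm σ'] at this
      have u : (a + a') * (σ * σ') ≤ (2 * M) * (lmax * lmax) := by
        apply mul_le_mul (by linarith) _ (by positivity) (by positivity)
        exact mul_le_mul hσ.2 hσ'.2 σpos'.le hlmax.le
      have v := mul_le_mul_of_nonneg_left u (abs_nonneg (a - a'))
      rw [one_div_mul_eq_div, div_le_iff₀ (by positivity)]
      nlinarith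
    have w : Real.exp (-M) * (1 / (lmax ^ 2 * M) * |σ - σ'|) *
        (m / 2 * Real.exp (-(M * (2 * R + 1)))) ≤
        Real.exp (-M) * |a - a'| * (m / 2 * Real.exp (-(M * (2 * R + 1)))) := by gcongr
    have : c1 * |σ - σ'| = (Real.exp (-M) * (1 / (lmax ^ 2 * M) * |σ - σ'|) *
        (m / 2 * Real.exp (-(M * (2 * R + 1))))) / 2 := by rw [hc1]; ring
    rw [this]; linarith
  have s1' : |σ - σ'| ≤ 1 / c1 * D := by
    rw [one_div_mul_eq_div, le_div_iff₀ c1pos]; linarith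
  have s2 : ∀ b : ℝ, 0 < b → ∀ h : ℝ → ℝ, LipschitzWith 1 h →
      (∫ x, h x ∂P) - ∫ x, h x ∂P' ≤ 8 / b + R * D + b * ((2 * lmax + 2 / c1) * D) := by
    intro b hb h hL
    obtain ⟨k, kL, kB, hk⟩ := clip_lemma hR hL
    rw [hk P P' ‹_› ‹_› hP hP']
    refine (key_bound ha ha' hb kL kB).trans ?_
    rw [← hD, ha2, ha2']
    have e1 : b ^ 2 / (2 / σ) * (4 / b) = 2 * b * σ := by field_simp; ring
    have e2 : |b ^ 2 / (2 / σ) - b ^ 2 / (2 / σ')| * (4 / b) = 2 * b * |σ - σ'| := by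
      have : b ^ 2 / (2 / σ) - b ^ 2 / (2 / σ') = b ^ 2 / 2 * (σ - σ') := by field_simp
      rw [this, abs_mul, abs_of_pos (by positivity)]; field_simp; ring
    rw [e1, e2]
    have f1 : 2 * b * σ * D ≤ 2 * b * lmax * D := by
      have := hσ.2
      gcongr
    have f2 : 2 * b * |σ - σ'| ≤ 2 * b * (1 / c1 * D) := by gcongr
    have : b * ((2 * lmax + 2 / c1) * D) = 2 * b * lmax * D + 2 * b * (1 / c1 * D) := by ring
    rw [this]
    linarith
  have W0 : 0 ≤ W1R P P' := by
    apply Real.sSup_nonneg'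
    exact ⟨0, ⟨fun _ => 0, LipschitzWith.const' 0, by simp⟩, le_rfl⟩
  have W1 : W1R P P' ≤ K * Real.sqrt D := by
    apply Real.sSup_le _ (by positivity)
    rintro r ⟨h, hL, rfl⟩
    rcases D0.eq_or_lt with hz | hpos
    · rw [← hz] at s2 ⊢
      simp only [mul_zero, add_zero, Real.sqrt_zero] at s2 ⊢
      by_contra hcon
      push Not at hcon
      set r := (∫ x, h x ∂P) - ∫ x, h x ∂P'
      have := s2 (16 / r) (by positivity) h hL
      have e : 8 / (16 / r) = r / 2 := by field_simp; norm_num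
      rw [e] at this
      change r ≤ r / 2 at this
      linarith
    · have sp : 0 < Real.sqrt D := Real.sqrt_pos.2 hpos
      have ss : Real.sqrt D * Real.sqrt D = D := Real.mul_self_sqrt D0
      have := s2 (1 / Real.sqrt D) (by positivity) h hL
      have e1 : 8 / (1 / Real.sqrt D) = 8 * Real.sqrt D := by field_simp
      have e2 : 1 / Real.sqrt D * ((2 * lmax + 2 / c1) * D) =
          (2 * lmax + 2 / c1) * Real.sqrt D := by
        rw [one_div_mul_eq_div, div_eq_iff sp.ne', mul_assoc, ss]
      rw [e1, e2] at this
      have e3 : D ≤ 2 * Real.sqrt D := by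
        have : Real.sqrt D ≤ 2 := by nlinarith
        nlinarith
      have e4 : R * D ≤ R * (2 * Real.sqrt D) := by gcongr
      rw [hK]
      linarith
  have W2 : W1R P P' ^ 2 ≤ K ^ 2 * D := by
    have := pow_le_pow_left₀ W0 W1 2
    rwa [mul_pow, Real.sq_sqrt D0] at this
  rw [one_div_mul_eq_div, div_le_iff₀ (by positivity)]
  linarith
end
end

section
/- There exist positive constants M and C' (depending only on R, λmin, λmax) such that for all Borel probability measures P, P' on ℝ supported in [−R, R] and all variances v, v' ∈ [λmin, λmax] with v ≠ v', writing γ² := |v − v'|, one has ∫_ℝ |p_{P,v}(x) − p_{P',v'}(x)| dx ≥ C' · exp( −M · log(1/γ²) / γ² ). -/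
open MeasureTheory

noncomputable section

/-- The univariate Gaussian density with mean θ and variance v. -/
noncomputable def gaussDens (θ v x : ℝ) : ℝ :=
  (Real.sqrt (2 * Real.pi * v))⁻¹ * Real.exp (-(x - θ) ^ 2 / (2 * v))

/-- Univariate Gaussian mixture density. -/
noncomputable def gaussMix1 (P : Measure ℝ) (v : ℝ) : ℝ → ℝ :=
  fun x => ∫ θ, gaussDens θ v x ∂P
open ProbabilityTheory in
lemma gsep_dens_eq (θ x : ℝ) {v : ℝ} (hv : 0 < v) :
    gaussDens θ v x = gaussianPDFReal θ v.toNNReal x := by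
  simp [gaussDens, gaussianPDFReal, Real.coe_toNNReal _ hv.le]

lemma gsep_dens_nonneg (θ v x : ℝ) : 0 ≤ gaussDens θ v x := by
  unfold gaussDens; positivity

lemma gsep_mix_nonneg (P : Measure ℝ) (v x : ℝ) : 0 ≤ gaussMix1 P v x :=
  integral_nonneg fun θ => gsep_dens_nonneg θ v x

open ProbabilityTheory in
lemma gsep_integral_exp (θ : ℝ) {v : ℝ} (hv : 0 < v) (z : ℂ) :
    ∫ x : ℝ, (gaussDens θ v x : ℂ) * Complex.exp (z * x) = Complex.exp (z * θ + v * z ^ 2 / 2) := by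
  have hv' : v.toNNReal ≠ 0 := by simpa using hv
  have h := complexMGF_id_gaussianReal (μ := θ) (v := v.toNNReal) z
  rw [complexMGF, integral_gaussianReal_eq_integral_smul hv', Real.coe_toNNReal _ hv.le] at h
  rw [← h]
  congr 1
  ext x
  rw [gsep_dens_eq θ x hv]
  simp

open ProbabilityTheory in
lemma gsep_integral_rexp (θ : ℝ) {v : ℝ} (hv : 0 < v) (t : ℝ) :
    ∫ x : ℝ, gaussDens θ v x * Real.exp (t * x) = Real.exp (t * θ + v * t ^ 2 / 2) := by
  have h := gsep_integral_exp θ hv (t : ℂ)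
  apply Complex.ofReal_injective
  rw [← integral_complex_ofReal]
  push_cast
  exact h

open ProbabilityTheory in
lemma gsep_integrable_rexp (θ : ℝ) {v : ℝ} (hv : 0 < v) (t : ℝ) :
    Integrable (fun x : ℝ => gaussDens θ v x * Real.exp (t * x)) := by
  by_contra hcon
  have h := gsep_integral_rexp θ hv t
  rw [integral_undef hcon] at h
  exact absurd h (Real.exp_pos _).ne

lemma gsep_measurable (v : ℝ) (z : ℂ) :
    Continuous (fun p : ℝ × ℝ => (gaussDens p.1 v p.2 : ℂ) * Complex.exp (z * p.2)) := by
  unfold gaussDens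
  fun_prop

lemma gsep_norm (θ v x : ℝ) (z : ℂ) :
    ‖(gaussDens θ v x : ℂ) * Complex.exp (z * x)‖ = gaussDens θ v x * Real.exp (z.re * x) := by
  rw [norm_mul, Complex.norm_real, Real.norm_of_nonneg (gsep_dens_nonneg _ _ _), Complex.norm_exp]
  simp

lemma gsep_ae {P : Measure ℝ} {R : ℝ} (hP : P (Set.Icc (-R) R)ᶜ = 0) :
    ∀ᵐ θ ∂P, |θ| ≤ R := by
  filter_upwards [compl_mem_ae_iff.2 hP] with θ hθ
  rw [compl_compl] at hθ
  exact abs_le.2 hθ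

lemma gsep_integrable_exp_mix {P : Measure ℝ} [IsProbabilityMeasure P] {R : ℝ}
    (hP : P (Set.Icc (-R) R)ᶜ = 0) {f : ℝ → ℝ} (hf : Continuous f) : Integrable f P := by
  obtain ⟨C, hC⟩ := (isCompact_Icc (a := -R) (b := R)).exists_bound_of_continuousOn hf.continuousOn
  refine Integrable.of_bound hf.aestronglyMeasurable C ?_
  filter_upwards [gsep_ae hP] with θ hθ using hC θ (abs_le.1 hθ)

lemma gsep_integrable_prod {P : Measure ℝ} [IsProbabilityMeasure P] {R : ℝ}
    (hP : P (Set.Icc (-R) R)ᶜ = 0) {v : ℝ} (hv : 0 < v) (z : ℂ) :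
    Integrable (fun p : ℝ × ℝ => (gaussDens p.1 v p.2 : ℂ) * Complex.exp (z * p.2))
      (P.prod volume) := by
  rw [integrable_prod_iff (gsep_measurable v z).aestronglyMeasurable]
  constructor
  · refine Filter.Eventually.of_forall fun θ => ?_
    rw [← integrable_norm_iff]
    · simp only [gsep_norm]
      exact gsep_integrable_rexp θ hv _
    · exact ((gsep_measurable v z).comp (by fun_prop : Continuous fun x : ℝ => (θ, x))).aestronglyMeasurable
  · simp only [gsep_norm, gsep_integral_rexp _ hv]
    exact gsep_integrable_exp_mix hP (by fun_prop)

lemma gsep_mix_mul (P : Measure ℝ) (v : ℝ) (z : ℂ) (x : ℝ) :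
    (gaussMix1 P v x : ℂ) * Complex.exp (z * x)
      = ∫ θ, (gaussDens θ v x : ℂ) * Complex.exp (z * x) ∂P := by
  rw [integral_mul_const, gaussMix1, integral_complex_ofReal]

lemma gsep_mix_integrable {P : Measure ℝ} [IsProbabilityMeasure P] {R : ℝ}
    (hP : P (Set.Icc (-R) R)ᶜ = 0) {v : ℝ} (hv : 0 < v) (z : ℂ) :
    Integrable (fun x : ℝ => (gaussMix1 P v x : ℂ) * Complex.exp (z * x)) := by
  simp only [gsep_mix_mul]
  exact (gsep_integrable_prod hP hv z).integral_prod_right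

lemma gsep_mix_integrable_real {P : Measure ℝ} [IsProbabilityMeasure P] {R : ℝ}
    (hP : P (Set.Icc (-R) R)ᶜ = 0) {v : ℝ} (hv : 0 < v) (t : ℝ) :
    Integrable (fun x : ℝ => gaussMix1 P v x * Real.exp (t * x)) := by
  have h := (gsep_mix_integrable hP hv (t : ℂ)).re
  refine h.congr (Filter.Eventually.of_forall fun x => ?_)
  simp only [RCLike.re_eq_complex_re]
  rw [Complex.re_ofReal_mul, ← Complex.ofReal_mul, ← Complex.ofReal_exp, Complex.ofReal_re]

open ProbabilityTheory in
lemma gsep_mix_integral {P : Measure ℝ} [IsProbabilityMeasure P] {R : ℝ}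
    (hP : P (Set.Icc (-R) R)ᶜ = 0) {v : ℝ} (hv : 0 < v) (z : ℂ) :
    ∫ x : ℝ, (gaussMix1 P v x : ℂ) * Complex.exp (z * x)
      = Complex.exp (v * z ^ 2 / 2) * complexMGF id P z := by
  simp only [gsep_mix_mul]
  rw [← integral_integral_swap (f := fun θ x => (gaussDens θ v x : ℂ) * Complex.exp (z * x))
    (gsep_integrable_prod hP hv z)]
  simp only [gsep_integral_exp _ hv, complexMGF, id]
  rw [← integral_const_mul]
  congr 1
  ext θ
  rw [← Complex.exp_add, add_comm]

lemma gsep_mix_integral_real {P : Measure ℝ} [IsProbabilityMeasure P] {R : ℝ}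
    (hP : P (Set.Icc (-R) R)ᶜ = 0) {v : ℝ} (hv : 0 < v) (t : ℝ) :
    ∫ x : ℝ, gaussMix1 P v x * Real.exp (t * x) ≤ Real.exp (v * t ^ 2 / 2 + |t| * R) := by
  have h := gsep_mix_integral hP hv (t : ℂ)
  rw [ProbabilityTheory.complexMGF_ofReal] at h
  have h2 : ∫ x : ℝ, gaussMix1 P v x * Real.exp (t * x)
      = Real.exp (v * t ^ 2 / 2) * ProbabilityTheory.mgf id P t := by
    apply Complex.ofReal_injective
    rw [← integral_complex_ofReal]
    push_cast
    exact h
  rw [h2, Real.exp_add]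
  gcongr
  unfold ProbabilityTheory.mgf
  calc ∫ θ, Real.exp (t * id θ) ∂P ≤ ∫ θ, Real.exp (|t| * R) ∂P := by
        refine integral_mono_ae (gsep_integrable_exp_mix hP (by unfold id; fun_prop))
          (integrable_const _) ?_
        filter_upwards [gsep_ae hP] with θ hθ
        apply Real.exp_le_exp.2
        calc t * id θ ≤ |t * θ| := le_abs_self _
          _ = |t| * |θ| := abs_mul _ _
          _ ≤ _ := by gcongr
    _ = _ := by simp

/-- Even/odd moments of the centered Gaussian of variance `c`. -/
def gsepMom (c : ℝ) : ℕ → ℝ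
  | 0 => 1
  | 1 => 0
  | n + 2 => c * (n + 1) * gsepMom c n

lemma gsepMom_nonneg {c : ℝ} (hc : 0 ≤ c) : ∀ n, 0 ≤ gsepMom c n
  | 0 => by simp [gsepMom]
  | 1 => by simp [gsepMom]
  | n + 2 => by
    have := gsepMom_nonneg hc n
    rw [gsepMom]; positivity

lemma gsepMom_odd (c : ℝ) (k : ℕ) : gsepMom c (2 * k + 1) = 0 := by
  induction k with
  | zero => simp [gsepMom]
  | succ k ih => rw [show 2 * (k + 1) + 1 = (2 * k + 1) + 2 by ring, gsepMom, ih, mul_zero]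

lemma gsepMom_even (c : ℝ) (k : ℕ) :
    gsepMom c (2 * k) = (c / 2) ^ k * ((2 * k).factorial / k.factorial) := by
  induction k with
  | zero => simp [gsepMom]
  | succ k ih =>
    rw [show 2 * (k + 1) = 2 * k + 2 by ring, gsepMom, ih, Nat.factorial_succ, Nat.factorial_succ,
      Nat.factorial_succ]
    push_cast
    field_simp
    ring

lemma gsepMom_even_ge {c : ℝ} (hc : 0 ≤ c) (k : ℕ) :
    (c / 2 * k) ^ k ≤ gsepMom c (2 * k) := by
  rw [gsepMom_even, mul_pow]
  gcongr
  rw [le_div_iff₀ (by positivity)]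
  have h := Nat.factorial_mul_pow_le_factorial (m := k) (n := k)
  have h2 : k ^ k * k.factorial ≤ (2 * k).factorial := by
    calc k ^ k * k.factorial ≤ (k + 1) ^ k * k.factorial := by gcongr; omega
      _ = k.factorial * (k + 1) ^ k := mul_comm _ _
      _ ≤ (k + k).factorial := h
      _ = _ := by rw [two_mul]
  exact_mod_cast h2

lemma gsep_gauss_contDiff (c : ℂ) {n : WithTop ℕ∞} :
    ContDiff ℂ n (fun z : ℂ => Complex.exp (c * z ^ 2 / 2)) := by
  fun_prop

lemma gsep_gauss_rec (c : ℂ) (n : ℕ) :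
    ∀ z, iteratedDeriv (n + 2) (fun z : ℂ => Complex.exp (c * z ^ 2 / 2)) z
      = c * z * iteratedDeriv (n + 1) (fun z : ℂ => Complex.exp (c * z ^ 2 / 2)) z
        + c * (n + 1) * iteratedDeriv n (fun z : ℂ => Complex.exp (c * z ^ 2 / 2)) z := by
  set g := fun z : ℂ => Complex.exp (c * z ^ 2 / 2) with hg
  have hd : ∀ m z, HasDerivAt (iteratedDeriv m g) (iteratedDeriv (m + 1) g z) z := by
    intro m z
    rw [iteratedDeriv_succ]
    exact ((gsep_gauss_contDiff c (n := ⊤)).differentiable_iteratedDeriv m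
      (WithTop.coe_lt_top _) z).hasDerivAt
  have h1 : ∀ z, iteratedDeriv 1 g z = c * z * g z := by
    intro z
    have h := (((hasDerivAt_id z).pow 2).const_mul (c / 2)).cexp
    rw [iteratedDeriv_one]
    refine HasDerivAt.deriv ?_
    convert! h using 1
    · ext y; simp [hg]; ring_nf
    · simp [hg]; ring_nf
  induction n with
  | zero =>
    intro z
    have e : iteratedDeriv 1 g = fun z => c * z * g z := funext h1
    rw [show 0 + 2 = 1 + 1 by rfl, iteratedDeriv_succ]
    refine HasDerivAt.deriv ?_
    have h0 := hd 0 z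
    simp only [iteratedDeriv_zero] at h0
    have h := ((hasDerivAt_id z).const_mul c).mul h0
    rw [e]
    convert! h using 1
    simp [e]; ring
  | succ n ih =>
    intro z
    have e := funext ih
    rw [show n + 1 + 2 = (n + 2) + 1 by rfl, iteratedDeriv_succ, e]
    refine HasDerivAt.deriv ?_
    have h := (((hasDerivAt_id z).const_mul c).mul (hd (n + 1) z)).add
      ((hd n z).const_mul (c * (n + 1)))
    rw [show n + 1 + 1 = n + 2 from rfl, ih] at h
    convert! h using 1
    push_cast
    simp; ring

lemma gsep_gauss_iter (c : ℝ) : ∀ n : ℕ,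
    iteratedDeriv n (fun z : ℂ => Complex.exp (c * z ^ 2 / 2)) 0 = (gsepMom c n : ℂ)
  | 0 => by simp [gsepMom]
  | 1 => by
    rw [iteratedDeriv_one]
    refine HasDerivAt.deriv ?_
    have h := (((hasDerivAt_id (0 : ℂ)).pow 2).const_mul ((c : ℂ) / 2)).cexp
    convert! h using 1
    · ext y; simp; ring_nf
    · simp [gsepMom]
  | n + 2 => by
    rw [gsep_gauss_rec, gsep_gauss_iter c n, gsepMom]
    push_cast; ring

section

open ProbabilityTheory

lemma gsep_expSet {P : Measure ℝ} [IsProbabilityMeasure P] {R : ℝ}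
    (hP : P (Set.Icc (-R) R)ᶜ = 0) : interior (integrableExpSet id P) = Set.univ := by
  have : integrableExpSet id P = Set.univ := by
    ext t
    simp only [Set.mem_univ, iff_true]
    exact gsep_integrable_exp_mix hP (by unfold id; fun_prop)
  rw [this, interior_univ]

lemma gsep_mgf_diff {P : Measure ℝ} [IsProbabilityMeasure P] {R : ℝ}
    (hP : P (Set.Icc (-R) R)ᶜ = 0) : Differentiable ℂ (complexMGF id P) := fun z =>
  (hasDerivAt_complexMGF (by rw [gsep_expSet hP]; trivial)).differentiableAt

lemma gsep_mgf_iter {P : Measure ℝ} [IsProbabilityMeasure P] {R : ℝ}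
    (hP : P (Set.Icc (-R) R)ᶜ = 0) (n : ℕ) :
    iteratedDeriv n (complexMGF id P) 0 = ((∫ θ, θ ^ n ∂P : ℝ) : ℂ) := by
  rw [iteratedDeriv_complexMGF (by rw [gsep_expSet hP]; trivial), ← integral_complex_ofReal]
  simp

lemma gsep_mom_le {P : Measure ℝ} [IsProbabilityMeasure P] {R : ℝ}
    (hP : P (Set.Icc (-R) R)ᶜ = 0) (k : ℕ) : ∫ θ, θ ^ (2 * k) ∂P ≤ R ^ (2 * k) := by
  calc ∫ θ, θ ^ (2 * k) ∂P ≤ ∫ θ, R ^ (2 * k) ∂P := by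
        refine integral_mono_ae (gsep_integrable_exp_mix hP (by fun_prop)) (integrable_const _) ?_
        filter_upwards [gsep_ae hP] with θ hθ
        rw [← (even_two_mul k).pow_abs θ]
        gcongr
    _ = _ := by simp

/-- The key derivative lower bound. -/
lemma gsep_iter_lower {P P' : Measure ℝ} [IsProbabilityMeasure P] [IsProbabilityMeasure P'] {R : ℝ}
    (hP : P (Set.Icc (-R) R)ᶜ = 0) (hP' : P' (Set.Icc (-R) R)ᶜ = 0) {c : ℝ} (hc : 0 ≤ c) (k : ℕ) :
    (c / 2 * k) ^ k - R ^ (2 * k) ≤ ‖iteratedDeriv (2 * k)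
      ((fun z : ℂ => Complex.exp (c * z ^ 2 / 2)) * complexMGF id P - complexMGF id P') 0‖ := by
  have c1 : ContDiff ℂ (2 * k : ℕ) (complexMGF id P) := (gsep_mgf_diff hP).contDiff
  have c2 : ContDiff ℂ (2 * k : ℕ) (complexMGF id P') := (gsep_mgf_diff hP').contDiff
  have c3 : ContDiff ℂ (2 * k : ℕ) (fun z : ℂ => Complex.exp (c * z ^ 2 / 2)) :=
    gsep_gauss_contDiff _
  have c4 : ContDiffAt ℂ (2 * k : ℕ)
      ((fun z : ℂ => Complex.exp (c * z ^ 2 / 2)) * complexMGF id P) 0 := (c3.mul c1).contDiffAt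
  rw [iteratedDeriv_sub c4 c2.contDiffAt,
    iteratedDeriv_mul c3.contDiffAt c1.contDiffAt]
  simp only [gsep_gauss_iter, gsep_mgf_iter hP, gsep_mgf_iter hP']
  set S : ℝ := ∑ i ∈ Finset.range (2 * k + 1),
    (2 * k).choose i * gsepMom c i * ∫ θ, θ ^ (2 * k - i) ∂P with hS
  have hSlow : (c / 2 * k) ^ k ≤ S := by
    have hnn : ∀ i ∈ Finset.range (2 * k + 1),
        0 ≤ (2 * k).choose i * gsepMom c i * ∫ θ, θ ^ (2 * k - i) ∂P := by
      intro i hi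
      rcases Nat.even_or_odd' i with ⟨j, rfl | rfl⟩
      · have h1 := gsepMom_nonneg hc (2 * j)
        have h2 : 0 ≤ ∫ θ, θ ^ (2 * k - 2 * j) ∂P := by
          refine integral_nonneg fun θ => ?_
          rw [← Nat.mul_sub]
          exact (even_two_mul _).pow_nonneg θ
        positivity
      · rw [gsepMom_odd]; simp
    have h := Finset.single_le_sum hnn (Finset.self_mem_range_succ (2 * k))
    refine le_trans ?_ h
    simpa using gsepMom_even_ge hc k
  have e : (∑ i ∈ Finset.range (2 * k + 1), ((2 * k).choose i : ℂ) * (gsepMom c i : ℂ)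
      * ((∫ θ, θ ^ (2 * k - i) ∂P : ℝ) : ℂ)) - ((∫ θ, θ ^ (2 * k) ∂P' : ℝ) : ℂ)
      = ((S - ∫ θ, θ ^ (2 * k) ∂P' : ℝ) : ℂ) := by
    rw [hS]; push_cast; rfl
  rw [e, Complex.norm_real]
  have := gsep_mom_le hP' k
  exact le_trans (by linarith) (le_abs_self _)

/-- Upper bound on the weighted L¹ distance with weight `exp (2|x|)`. -/
lemma gsep_weighted {P P' : Measure ℝ} [IsProbabilityMeasure P] [IsProbabilityMeasure P']
    {R L v v' : ℝ} (hP : P (Set.Icc (-R) R)ᶜ = 0) (hP' : P' (Set.Icc (-R) R)ᶜ = 0)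
    (hv : 0 < v) (hv' : 0 < v') (hvL : v ≤ L) (hvL' : v' ≤ L) :
    Integrable (fun x => |gaussMix1 P v x - gaussMix1 P' v' x| * Real.exp (2 * |x|)) ∧
    ∫ x, |gaussMix1 P v x - gaussMix1 P' v' x| * Real.exp (2 * |x|)
      ≤ 4 * Real.exp (2 * L + 2 * R) := by
  have i1 := gsep_mix_integrable_real hP hv 2
  have i2 := gsep_mix_integrable_real hP hv (-2)
  have i3 := gsep_mix_integrable_real hP' hv' 2
  have i4 := gsep_mix_integrable_real hP' hv' (-2)
  have b : ∀ (Q : Measure ℝ) [IsProbabilityMeasure Q] (w t : ℝ), Q (Set.Icc (-R) R)ᶜ = 0 →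
      0 < w → w ≤ L → |t| = 2 →
      ∫ x : ℝ, gaussMix1 Q w x * Real.exp (t * x) ≤ Real.exp (2 * L + 2 * R) := by
    intro Q _ w t hQ hw hwL ht
    refine (gsep_mix_integral_real hQ hw t).trans (Real.exp_le_exp.2 ?_)
    rw [← sq_abs, ht]; linarith
  have b1 := b P v 2 hP hv hvL (by norm_num)
  have b2 := b P v (-2) hP hv hvL (by norm_num)
  have b3 := b P' v' 2 hP' hv' hvL' (by norm_num)
  have b4 := b P' v' (-2) hP' hv' hvL' (by norm_num)
  have isum := (i1.add i2).add (i3.add i4)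
  have hle : ∀ x, |gaussMix1 P v x - gaussMix1 P' v' x| * Real.exp (2 * |x|) ≤
      (gaussMix1 P v x * Real.exp (2 * x) + gaussMix1 P v x * Real.exp (-2 * x)) +
      (gaussMix1 P' v' x * Real.exp (2 * x) + gaussMix1 P' v' x * Real.exp (-2 * x)) := by
    intro x
    have h1 := gsep_mix_nonneg P v x
    have h2 := gsep_mix_nonneg P' v' x
    have h3 : |gaussMix1 P v x - gaussMix1 P' v' x| ≤ gaussMix1 P v x + gaussMix1 P' v' x :=
      abs_le.2 ⟨by linarith, by linarith⟩
    have h4 : Real.exp (2 * |x|) ≤ Real.exp (2 * x) + Real.exp (-2 * x) := by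
      have e1 := Real.exp_pos (2 * x)
      have e2 := Real.exp_pos (-2 * x)
      rcases abs_cases x with ⟨h, _⟩ | ⟨h, _⟩ <;> rw [h]
      · linarith
      · rw [show 2 * -x = -2 * x by ring]; linarith
    calc _ ≤ (gaussMix1 P v x + gaussMix1 P' v' x) * (Real.exp (2 * x) + Real.exp (-2 * x)) := by
          gcongr
      _ = _ := by ring
  have m : AEStronglyMeasurable
      (fun x => |gaussMix1 P v x - gaussMix1 P' v' x| * Real.exp (2 * |x|)) := by
    have m1 := gsep_mix_integrable_real hP hv 0
    have m2 := gsep_mix_integrable_real hP' hv' 0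
    simp only [zero_mul, Real.exp_zero, mul_one] at m1 m2
    exact (m1.sub m2).abs.aestronglyMeasurable.mul
      (by fun_prop : Continuous fun x : ℝ => Real.exp (2 * |x|)).aestronglyMeasurable
  have int : Integrable (fun x => |gaussMix1 P v x - gaussMix1 P' v' x| * Real.exp (2 * |x|)) := by
    refine isum.mono' m (Filter.Eventually.of_forall fun x => ?_)
    rw [Real.norm_of_nonneg (by positivity)]
    exact hle x
  refine ⟨int, (integral_mono int isum hle).trans ?_⟩
  rw [integral_add' (i1.add i2) (i3.add i4), integral_add' i1 i2, integral_add' i3 i4]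
  linarith

/-- Core estimate: for `v' < v` and every `k` we get a lower bound on the L¹ distance. -/
lemma gsep_core {P P' : Measure ℝ} [IsProbabilityMeasure P] [IsProbabilityMeasure P']
    {R L v v' : ℝ} (hR : 0 < R) (hP : P (Set.Icc (-R) R)ᶜ = 0) (hP' : P' (Set.Icc (-R) R)ᶜ = 0)
    (hv' : 0 < v') (hvL : v ≤ L) (hlt : v' < v) (k : ℕ) (hk : k ≠ 0)
    (hk2 : 4 * R ^ 2 ≤ (v - v') * k) :
    (4 * Real.exp (3 * L + 2 * R))⁻¹ * (R ^ (2 * k) / (2 * k).factorial) ^ 2 ≤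
      ∫ x, |gaussMix1 P v x - gaussMix1 P' v' x| := by
  have hv : 0 < v := hv'.trans hlt
  obtain ⟨iw, bw⟩ := gsep_weighted hP hP' hv hv' hvL (hlt.le.trans hvL)
  have m1 := gsep_mix_integrable_real hP hv 0
  have m2 := gsep_mix_integrable_real hP' hv' 0
  simp only [zero_mul, Real.exp_zero, mul_one] at m1 m2
  have i0 := (m1.sub m2).abs
  simp only [Pi.sub_apply] at i0
  set d := fun x => |gaussMix1 P v x - gaussMix1 P' v' x| with hd
  have dnn : ∀ x, 0 ≤ d x := fun x => abs_nonneg _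
  -- for each weight
  have amgm : ∀ a : ℝ, 0 < a → ∀ x, d x * Real.exp |x| ≤
      a / 2 * d x + 1 / (2 * a) * (d x * Real.exp (2 * |x|)) := by
    intro a ha x
    have e : Real.exp (2 * |x|) = Real.exp |x| ^ 2 := by
      rw [← Real.exp_nat_mul]; norm_num
    rw [e]
    have h : Real.exp |x| ≤ a / 2 + 1 / (2 * a) * Real.exp |x| ^ 2 := by
      have : a / 2 + 1 / (2 * a) * Real.exp |x| ^ 2 - Real.exp |x|
          = (a - Real.exp |x|) ^ 2 / (2 * a) := by field_simp; ring
      have h2 : 0 ≤ (a - Real.exp |x|) ^ 2 / (2 * a) := by positivity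
      linarith
    calc _ ≤ d x * (a / 2 + 1 / (2 * a) * Real.exp |x| ^ 2) := by gcongr
      _ = _ := by ring
  have iJ : Integrable (fun x => d x * Real.exp |x|) := by
    refine ((i0.const_mul (1 / 2)).add (iw.const_mul (1 / (2 * 1)))).mono'
      (i0.aestronglyMeasurable.mul
        (by fun_prop : Continuous fun x : ℝ => Real.exp |x|).aestronglyMeasurable)
      (Filter.Eventually.of_forall fun x => ?_)
    rw [Real.norm_of_nonneg (mul_nonneg (dnn x) (Real.exp_pos _).le)]
    exact amgm 1 one_pos x
  set J := ∫ x, d x * Real.exp |x| with hJ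
  have hJa : ∀ a : ℝ, 0 < a → J ≤ a / 2 * (∫ x, d x)
      + 1 / (2 * a) * (4 * Real.exp (2 * L + 2 * R)) := by
    intro a ha
    have h := integral_mono iJ ((i0.const_mul (a / 2)).add (iw.const_mul (1 / (2 * a))))
      (amgm a ha)
    simp only [Pi.add_apply] at h
    rw [integral_add (i0.const_mul (a / 2)) (iw.const_mul (1 / (2 * a))), integral_const_mul,
      integral_const_mul] at h
    refine h.trans ?_
    gcongr
  -- the analytic function
  set G : ℂ → ℂ := (fun z : ℂ => Complex.exp (((v - v' : ℝ) : ℂ) * z ^ 2 / 2)) * complexMGF id P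
    - complexMGF id P' with hG
  have hGd : Differentiable ℂ G :=
    ((gsep_gauss_contDiff ((v - v' : ℝ) : ℂ) (n := 1)).differentiable (by norm_num)).mul
      (gsep_mgf_diff hP) |>.sub (gsep_mgf_diff hP')
  have hGb : ∀ z ∈ Metric.sphere (0 : ℂ) 1, ‖G z‖ ≤ Real.exp (L / 2) * J := by
    intro z hz
    have hz1 : ‖z‖ = 1 := by simpa using hz
    have e : G z = Complex.exp (-(v' * z ^ 2 / 2)) *
        ∫ x : ℝ, ((gaussMix1 P v x - gaussMix1 P' v' x : ℝ) : ℂ) * Complex.exp (z * x) := by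
      have : ∀ x : ℝ, ((gaussMix1 P v x - gaussMix1 P' v' x : ℝ) : ℂ) * Complex.exp (z * x)
          = (gaussMix1 P v x : ℂ) * Complex.exp (z * x)
            - (gaussMix1 P' v' x : ℂ) * Complex.exp (z * x) := by
        intro x; push_cast; ring
      simp only [this]
      rw [integral_sub (gsep_mix_integrable hP hv z) (gsep_mix_integrable hP' hv' z),
        gsep_mix_integral hP hv, gsep_mix_integral hP' hv', mul_sub, ← mul_assoc, ← mul_assoc,
        ← Complex.exp_add, ← Complex.exp_add]
      simp only [hG, Pi.sub_apply, Pi.mul_apply]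
      congr 2
      · congr 1; push_cast; ring
      · simp
    rw [e, norm_mul]
    gcongr
    · refine (Complex.norm_exp_le_exp_norm _).trans (Real.exp_le_exp.2 ?_)
      rw [norm_neg, norm_div, norm_mul, norm_pow, hz1, Complex.norm_real,
        Real.norm_of_nonneg hv'.le]
      simp; linarith
    · refine (norm_integral_le_integral_norm _).trans ?_
      refine integral_mono_of_nonneg (Filter.Eventually.of_forall fun x => norm_nonneg _) iJ
        (Filter.Eventually.of_forall fun x => ?_)
      simp only [norm_mul, Complex.norm_real, Real.norm_eq_abs, hd]
      gcongr
      refine (Complex.norm_exp_le_exp_norm _).trans (Real.exp_le_exp.2 ?_)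
      rw [norm_mul, hz1, Complex.norm_real]; simp
  have hC := Complex.norm_iteratedDeriv_le_of_forall_mem_sphere_norm_le (2 * k) one_pos
    hGd.diffContOnCl hGb
  have hlow := gsep_iter_lower hP hP' (sub_pos.2 hlt).le k
  rw [one_pow, div_one] at hC
  have hpow : 2 * R ^ (2 * k) ≤ ((v - v') / 2 * k) ^ k := by
    calc 2 * R ^ (2 * k) ≤ 2 ^ k * R ^ (2 * k) := by
          gcongr
          calc (2 : ℝ) = 2 ^ 1 := by norm_num
            _ ≤ 2 ^ k := pow_le_pow_right₀ (by norm_num) (Nat.one_le_iff_ne_zero.2 hk)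
      _ = (2 * R ^ 2) ^ k := by rw [pow_mul, mul_pow]
      _ ≤ _ := pow_le_pow_left₀ (by positivity) (by linarith) k
  have hfin : R ^ (2 * k) ≤ (2 * k).factorial * (Real.exp (L / 2) * J) := by
    have := hlow.trans hC
    linarith
  set r := R ^ (2 * k) / (2 * k).factorial with hr
  have hrpos : 0 < r := by positivity
  have hrJ : r ≤ Real.exp (L / 2) * J := by
    rw [hr, div_le_iff₀ (by positivity)]; linarith
  set K := 4 * Real.exp (2 * L + 2 * R) with hK
  have hKpos : 0 < K := by positivity
  have hKe : 4 * Real.exp (3 * L + 2 * R) = K * Real.exp (L / 2) ^ 2 := by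
    rw [hK, ← Real.exp_nat_mul, mul_assoc, ← Real.exp_add]; congr 2; push_cast; ring
  rw [hKe]
  have hEpos := Real.exp_pos (L / 2)
  set E := Real.exp (L / 2)
  set j := r / E with hj
  have hjpos : 0 < j := by positivity
  have hjJ : j ≤ J := by rw [hj, div_le_iff₀ hEpos]; linarith
  have h := hJa (K / j) (by positivity)
  have h2 : 1 / (2 * (K / j)) * K = j / 2 := by field_simp
  rw [h2] at h
  have h3 : j / 2 ≤ K / j / 2 * ∫ x, d x := by linarith
  have h4 : (K * E ^ 2)⁻¹ * r ^ 2 = j / 2 / (K / j / 2) := by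
    rw [hj]; field_simp
  rw [h4, div_le_iff₀ (by positivity)]
  linarith

lemma gsep_numeric {R lam x L₁ A : ℝ} (hR : 0 < R) (hx : 0 < x) (hxl : x ≤ lam) (hA : 0 < A)
    (h : ∀ k : ℕ, k ≠ 0 → 4 * R ^ 2 ≤ x * k →
      A⁻¹ * (R ^ (2 * k) / (2 * k).factorial) ^ 2 ≤ L₁) :
    A⁻¹ * Real.exp (-(4 * (4 * R ^ 2 + 2 * lam) / x *
      (|Real.log (2 * (4 * R ^ 2 + 2 * lam) / R)| + |Real.log x|))) ≤ L₁ := by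
  set D := 4 * R ^ 2 + 2 * lam with hD
  have hlam : 0 < lam := hx.trans_le hxl
  have hDpos : 0 < D := by positivity
  set k := ⌈4 * R ^ 2 / x⌉₊ + 1 with hk
  have hk1 : 4 * R ^ 2 / x ≤ k := by
    rw [hk]; push_cast
    linarith [Nat.le_ceil (4 * R ^ 2 / x)]
  have hk2 : (k : ℝ) ≤ D / x := by
    rw [hk]; push_cast
    have h1 := Nat.ceil_lt_add_one (a := 4 * R ^ 2 / x) (by positivity)
    have h2 : D / x = 4 * R ^ 2 / x + 2 * (lam / x) := by rw [hD]; ring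
    have h3 : 1 ≤ lam / x := (one_le_div hx).2 hxl
    linarith
  have hkpos : (0 : ℝ) < k := by rw [hk]; positivity
  have hk0 : k ≠ 0 := by omega
  have h := h k hk0 (by rw [div_le_iff₀ hx] at hk1; linarith)
  refine le_trans ?_ h
  gcongr
  have hfac : ((2 * k).factorial : ℝ) ≤ (2 * k) ^ (2 * k) := by
    exact_mod_cast Nat.factorial_le_pow (2 * k)
  have h5 : R ^ (2 * k) / (2 * k : ℝ) ^ (2 * k) ≤ R ^ (2 * k) / (2 * k).factorial := by
    gcongr
  have h6 : (R ^ (2 * k) / (2 * k : ℝ) ^ (2 * k)) ^ 2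
      = Real.exp (-(4 * k * Real.log (2 * k / R))) := by
    have e : R / (2 * k) = Real.exp (-Real.log (2 * k / R)) := by
      rw [Real.exp_neg, Real.exp_log (by positivity), inv_div]
    rw [← div_pow, ← pow_mul, e, ← Real.exp_nat_mul]
    congr 1; push_cast; ring
  calc _ ≤ Real.exp (-(4 * k * Real.log (2 * k / R))) := by
        apply Real.exp_le_exp.2
        apply neg_le_neg
        have hl : Real.log (2 * k / R) ≤ |Real.log (2 * D / R)| + |Real.log x| := by
          calc Real.log (2 * k / R) ≤ Real.log (2 * (D / x) / R) := by
                apply Real.log_le_log (by positivity); gcongr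
            _ = Real.log (2 * D / R) - Real.log x := by
                rw [← Real.log_div (by positivity) hx.ne']; congr 1; field_simp
            _ ≤ _ := by linarith [le_abs_self (Real.log (2 * D / R)), neg_abs_le (Real.log x)]
        calc 4 * k * Real.log (2 * k / R)
            ≤ 4 * k * (|Real.log (2 * D / R)| + |Real.log x|) := by gcongr
          _ ≤ 4 * (D / x) * (|Real.log (2 * D / R)| + |Real.log x|) := by gcongr
          _ = _ := by ring
    _ = (R ^ (2 * k) / (2 * k : ℝ) ^ (2 * k)) ^ 2 := h6.symm
    _ ≤ _ := by gcongr

lemma gsep_numeric2 {D B lam x : ℝ} (hD : 0 < D) (hB : 0 ≤ B) (hlam : 0 < lam) (hx : 0 < x)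
    (hxl : x ≤ lam) :
    -(8 * D * (B + lam + 2) + 4 * D * (B / Real.log 2 + 1))
      - 4 * D * (B / Real.log 2 + 1) * Real.log (1 / x) / x
      ≤ -(4 * D / x * (B + |Real.log x|)) := by
  have hl2 : 0 < Real.log 2 := Real.log_pos (by norm_num)
  set M := 4 * D * (B / Real.log 2 + 1) with hM
  have hMpos : 0 < M := by positivity
  rw [one_div, Real.log_inv]
  rcases le_total x (1 / 2) with hx2 | hx2
  · have hlog : Real.log 2 ≤ -Real.log x := by
      rw [← Real.log_inv]
      apply Real.log_le_log (by norm_num)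
      rw [le_inv_comm₀ (by norm_num) hx]; linarith
    rw [abs_of_neg (by linarith)]
    have h1 : B ≤ B / Real.log 2 * (-Real.log x) := by
      calc B = B / Real.log 2 * Real.log 2 := by field_simp
        _ ≤ _ := by gcongr
    have h2 : 4 * D / x * (B + -Real.log x) ≤ M * -Real.log x / x := by
      calc 4 * D / x * (B + -Real.log x)
          ≤ 4 * D / x * (B / Real.log 2 * (-Real.log x) + -Real.log x) := by gcongr
        _ = _ := by rw [hM]; ring
    have h3 : 0 < 8 * D * (B + lam + 2) := by positivity
    linarith
  · have h1 : |Real.log x| ≤ lam + 2 := by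
      rw [abs_le]
      constructor
      · have := Real.one_sub_inv_le_log_of_pos hx
        have h3 : x⁻¹ ≤ 2 := by rw [inv_le_comm₀ hx (by norm_num)]; linarith
        linarith
      · have := Real.log_le_sub_one_of_pos hx
        linarith
    have h2 : 4 * D / x * (B + |Real.log x|) ≤ 8 * D * (B + lam + 2) := by
      calc 4 * D / x * (B + |Real.log x|) ≤ 4 * D / (1 / 2) * (B + (lam + 2)) := by gcongr
        _ = _ := by ring
    have h3 : M * Real.log x / x ≤ M := by
      rw [div_le_iff₀ hx]
      have := Real.log_le_sub_one_of_pos hx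
      gcongr; linarith
    have h4 : M * -Real.log x / x = -(M * Real.log x / x) := by ring
    rw [h4]
    linarith

end


/-- Univariate Gaussian scale separation (Assumption 1 for the Gaussian kernel,
univariate case): the L¹ distance between Gaussian mixtures with different
variances is bounded below in terms of the variance gap γ² = |v − v'|. -/
theorem univariate_gaussian_scale_separation
    (R lmin lmax : ℝ) (hR : 0 < R) (hlmin : 0 < lmin) (hl : lmin < lmax) :
    ∃ M C' : ℝ, 0 < M ∧ 0 < C' ∧
      ∀ (P P' : Measure ℝ), IsProbabilityMeasure P → IsProbabilityMeasure P' →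
        P (Set.Icc (-R) R)ᶜ = 0 → P' (Set.Icc (-R) R)ᶜ = 0 →
        ∀ v ∈ Set.Icc lmin lmax, ∀ v' ∈ Set.Icc lmin lmax, v ≠ v' →
          C' * Real.exp (-(M * Real.log (1 / |v - v'|) / |v - v'|)) ≤
          ∫ x, |gaussMix1 P v x - gaussMix1 P' v' x| := by
  set lam := lmax - lmin with hlam
  have hlampos : 0 < lam := sub_pos.2 hl
  set D := 4 * R ^ 2 + 2 * lam with hD
  have hDpos : 0 < D := by positivity
  set B := |Real.log (2 * D / R)| with hB
  have hBnn : 0 ≤ B := abs_nonneg _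
  have hl2 : 0 < Real.log 2 := Real.log_pos (by norm_num)
  refine ⟨4 * D * (B / Real.log 2 + 1), (4 * Real.exp (3 * lmax + 2 * R))⁻¹ *
    Real.exp (-(8 * D * (B + lam + 2) + 4 * D * (B / Real.log 2 + 1))), by positivity,
    by positivity, ?_⟩
  have main : ∀ (P P' : Measure ℝ), IsProbabilityMeasure P → IsProbabilityMeasure P' →
        P (Set.Icc (-R) R)ᶜ = 0 → P' (Set.Icc (-R) R)ᶜ = 0 →
        ∀ v ∈ Set.Icc lmin lmax, ∀ v' ∈ Set.Icc lmin lmax, v' < v →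
          (4 * Real.exp (3 * lmax + 2 * R))⁻¹ *
          Real.exp (-(8 * D * (B + lam + 2) + 4 * D * (B / Real.log 2 + 1))) *
          Real.exp (-(4 * D * (B / Real.log 2 + 1) * Real.log (1 / |v - v'|) / |v - v'|)) ≤
          ∫ x, |gaussMix1 P v x - gaussMix1 P' v' x| := by
    intro P P' _ _ hP hP' v hv v' hv' hlt
    have hx : 0 < v - v' := sub_pos.2 hlt
    have hxl : v - v' ≤ lam := by rw [hlam]; linarith [hv.2, hv'.1]
    rw [abs_of_pos hx]
    refine le_trans ?_ (gsep_numeric hR hx hxl (by positivity)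
      (fun k hk hk2 => gsep_core hR hP hP' (hlmin.trans_le hv'.1) hv.2 hlt k hk hk2))
    rw [mul_assoc, ← Real.exp_add]
    gcongr
    exact gsep_numeric2 hDpos hBnn hlampos hx hxl
  intro P P' hP1 hP1' hP hP' v hv v' hv' hne
  rcases lt_or_gt_of_ne hne with hlt | hlt
  · have h := main P' P hP1' hP1 hP' hP v' hv' v hv hlt
    rw [abs_sub_comm v' v] at h
    simpa only [abs_sub_comm (gaussMix1 P' v' _)] using h
  · exact main P P' hP1 hP1' hP hP' v hv v' hv' hlt
end
end
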